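/- There exists η₀ ∈ (0,1) such that for every η ∈ (0, η₀] there exists τ₀ > 0 such that for every τ ∈ (0, τ₀] and every ν ∈ (0, τ] there exists an integer n₀ so that the following holds. Let G be a digraph on n ≥ n₀ vertices with δ⁰(G) ≥ ηn that is both a robust (ν,τ)-outexpander and a robust (ν,τ)-inexpander. Let k be an integer with ⌈2/ν⌉ ≤ k ≤ νn/4, let x and y be distinct vertices of G, and let c : {0, 1, …, k−1} → {+1, −1} be any orientation pattern. Then there exist distinct vertices v₀, v₁, …, v_k of G with v₀ = x and v_k = y such that for every 0 ≤ i < k, (v_i, v_{i+1}) ∈ E(G) if c(i) = +1 and (v_{i+1}, v_i) ∈ E(G) if c(i) = −1; that is, G contains a path from x to y isomorphic to any prescribed orientation of a path of length k. -/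

import Mathlib

open Finset
open scoped Classical

/-- The out-degree of a vertex in a digraph given by its edge relation. -/
noncomputable def outDeg {V : Type*} [Fintype V] (G : V → V → Prop) (x : V) : ℕ :=
  (Finset.univ.filter fun y => G x y).card

/-- The in-degree of a vertex in a digraph given by its edge relation. -/
noncomputable def inDeg {V : Type*} [Fintype V] (G : V → V → Prop) (x : V) : ℕ :=
  (Finset.univ.filter fun y => G y x).card

/-- The `ν`-robust outneighbourhood of `S`: all vertices with at least `νn`
in-neighbours in `S`. -/
noncomputable def robustOutNbhd {V : Type*} [Fintype V] (G : V → V → Prop) (ν : ℝ)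
    (S : Finset V) : Finset V :=
  Finset.univ.filter fun v => ν * (Fintype.card V : ℝ) ≤ ((S.filter fun s => G s v).card : ℝ)

/-- The `ν`-robust inneighbourhood of `S`: all vertices with at least `νn`
out-neighbours in `S`. -/
noncomputable def robustInNbhd {V : Type*} [Fintype V] (G : V → V → Prop) (ν : ℝ)
    (S : Finset V) : Finset V :=
  Finset.univ.filter fun v => ν * (Fintype.card V : ℝ) ≤ ((S.filter fun s => G v s).card : ℝ)

/-- `G` is a robust `(ν,τ)`-outexpander. -/
def RobustOutexpander {V : Type*} [Fintype V] (G : V → V → Prop) (ν τ : ℝ) : Prop :=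
  ∀ S : Finset V, τ * (Fintype.card V : ℝ) < (S.card : ℝ) →
    (S.card : ℝ) < (1 - τ) * (Fintype.card V : ℝ) →
    (S.card : ℝ) + ν * (Fintype.card V : ℝ) ≤ ((robustOutNbhd G ν S).card : ℝ)

/-- `G` is a robust `(ν,τ)`-inexpander. -/
def RobustInexpander {V : Type*} [Fintype V] (G : V → V → Prop) (ν τ : ℝ) : Prop :=
  ∀ S : Finset V, τ * (Fintype.card V : ℝ) < (S.card : ℝ) →
    (S.card : ℝ) < (1 - τ) * (Fintype.card V : ℝ) →
    (S.card : ℝ) + ν * (Fintype.card V : ℝ) ≤ ((robustInNbhd G ν S).card : ℝ)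

/-- A directed Hamilton cycle in the digraph `G`: a cyclic ordering of all the
vertices such that consecutive vertices are joined by a directed edge. -/
def HasDiHamCycle {V : Type*} [Fintype V] (G : V → V → Prop) : Prop :=
  ∃ e : ZMod (Fintype.card V) ≃ V, ∀ i, G (e i) (e (i + 1))

/-- The vertices reachable robustly from `x` by a walk of length `j + 1` whose `i`-th edge lies in
`R i`. -/
noncomputable def robustReach {V : Type*} [Fintype V] (R : ℕ → V → V → Prop) (ν : ℝ) (x : V) :
    ℕ → Finset V
  | 0 => Finset.univ.filter fun v => R 0 x v
  | j + 1 => robustOutNbhd (R (j + 1)) ν (robustReach R ν x j)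

theorem robustOutNbhd_eq_univ {V : Type*} [Fintype V] {H : V → V → Prop} {ν τ η : ℝ}
    (hντ : ν ≤ τ) (hτη : 2 * τ ≤ η)
    (hdeg : ∀ v, η * (Fintype.card V : ℝ) ≤ (inDeg H v : ℝ)) {S : Finset V}
    (hS : (1 - τ) * (Fintype.card V : ℝ) ≤ (S.card : ℝ)) :
    robustOutNbhd H ν S = Finset.univ := by
  ext v
  simp only [robustOutNbhd, Finset.mem_filter, Finset.mem_univ, true_and, iff_true]
  have hsub : (Finset.univ.filter fun s => H s v) ⊆ (S.filter fun s => H s v) ∪ Sᶜ := by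
    intro s hs
    by_cases h : s ∈ S <;> simp_all
  have hle : (inDeg H v : ℝ) ≤ ((S.filter fun s => H s v).card : ℝ) + (Sᶜ.card : ℝ) := by
    exact_mod_cast (Finset.card_le_card hsub).trans (Finset.card_union_le _ _)
  have hc : (S.card : ℝ) + (Sᶜ.card : ℝ) = (Fintype.card V : ℝ) := by
    exact_mod_cast Finset.card_add_card_compl S
  have hn : (0 : ℝ) ≤ (Fintype.card V : ℝ) := Nat.cast_nonneg _
  nlinarith [hdeg v, mul_le_mul_of_nonneg_right hντ hn, mul_le_mul_of_nonneg_right hτη hn]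

theorem robustReach_eq_univ_or_le_card {V : Type*} [Fintype V] {R : ℕ → V → V → Prop}
    {ν τ η : ℝ} (hτ : 0 < τ) (hν : 0 < ν) (hντ : ν ≤ τ) (hτη : 2 * τ ≤ η)
    (hV : 0 < Fintype.card V)
    (hout : ∀ i v, η * (Fintype.card V : ℝ) ≤ (outDeg (R i) v : ℝ))
    (hin : ∀ i v, η * (Fintype.card V : ℝ) ≤ (inDeg (R i) v : ℝ))
    (hexp : ∀ i, RobustOutexpander (R i) ν τ) (x : V) (j : ℕ) :
    robustReach R ν x j = Finset.univ ∨
      (η + j * ν) * (Fintype.card V : ℝ) ≤ ((robustReach R ν x j).card : ℝ) := by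
  have hn : (0 : ℝ) < (Fintype.card V : ℝ) := by exact_mod_cast hV
  induction j with
  | zero => right; simpa [robustReach, outDeg] using hout 0 x
  | succ j ih =>
    by_cases hbig : (1 - τ) * (Fintype.card V : ℝ) ≤ ((robustReach R ν x j).card : ℝ)
    · exact Or.inl (robustOutNbhd_eq_univ hντ hτη (hin _) hbig)
    · rcases ih with ih | ih
      · refine absurd ?_ hbig
        rw [ih, Finset.card_univ]
        nlinarith
      · right
        have hj : (0 : ℝ) ≤ j * ν := by positivity
        have hlow : τ * (Fintype.card V : ℝ) < ((robustReach R ν x j).card : ℝ) :=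
          lt_of_lt_of_le (mul_lt_mul_of_pos_right (by linarith) hn) ih
        have h := hexp (j + 1) _ hlow (not_le.mp hbig)
        rw [robustReach]
        push_cast
        linarith

theorem exists_path_of_mem_robustReach {V : Type*} [Fintype V] {R : ℕ → V → V → Prop} {ν : ℝ}
    {x : V} (j : ℕ) : ∀ (y : V) (F : Finset V), y ∈ robustReach R ν x j → y ≠ x → y ∉ F → x ∉ F →
      (F.card : ℝ) + j + 2 < ν * (Fintype.card V : ℝ) →
      ∃ p : ℕ → V, p 0 = x ∧ p (j + 1) = y ∧ Set.InjOn p (Set.Iic (j + 1)) ∧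
        (∀ i ≤ j + 1, p i ∉ F) ∧ ∀ i ≤ j, R i (p i) (p (i + 1)) := by
  induction j with
  | zero =>
    intro y F hy hyx hyF hxF _
    refine ⟨fun i => if i = 0 then x else y, by simp, by simp, ?_, ?_, ?_⟩
    · intro a ha b hb hab
      simp only [Set.mem_Iic] at ha hb
      by_cases h₁ : a = 0 <;> by_cases h₂ : b = 0 <;> simp_all
      omega
    · intro i _
      dsimp only
      split_ifs <;> assumption
    · intro i hi
      obtain rfl : i = 0 := by omega
      simpa [robustReach] using hy
  | succ j ih =>
    intro y F hy hyx hyF hxF hF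
    simp only [robustReach, robustOutNbhd, Finset.mem_filter, Finset.mem_univ, true_and] at hy
    push_cast at hF
    have hcard : ((insert x (insert y F)).card : ℝ) ≤ F.card + 2 := by
      exact_mod_cast (Finset.card_insert_le _ _).trans
        (Nat.succ_le_succ (Finset.card_insert_le _ _))
    have hj : (0 : ℝ) ≤ j := Nat.cast_nonneg j
    obtain ⟨s, hs, hsF⟩ := Finset.exists_mem_notMem_of_card_lt_card
      (s := insert x (insert y F))
      (t := (robustReach R ν x j).filter fun s => R (j + 1) s y)
      (by
        have h : ((insert x (insert y F)).card : ℝ) <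
          (((robustReach R ν x j).filter fun s => R (j + 1) s y).card : ℝ) := by linarith
        exact_mod_cast h)
    simp only [Finset.mem_filter] at hs
    simp only [Finset.mem_insert, not_or] at hsF
    have hyc : ((insert y F).card : ℝ) ≤ F.card + 1 := by
      exact_mod_cast Finset.card_insert_le _ _
    obtain ⟨p, hp0, hpj, hinj, hpF, hpR⟩ := ih s (insert y F) hs.1 hsF.1
      (by simp [hsF.2.1, hsF.2.2]) (by simp [hyx.symm, hxF]) (by linarith)
    have hpF' : ∀ i ≤ j + 1, p i ≠ y ∧ p i ∉ F := fun i hi => by simpa using hpF i hi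
    refine ⟨fun i => if i ≤ j + 1 then p i else y, by simp [hp0], by simp, ?_, ?_, ?_⟩
    · intro a ha b hb hab
      simp only [Set.mem_Iic] at ha hb
      dsimp only at hab
      split_ifs at hab with h₁ h₂ h₂
      · exact hinj h₁ h₂ hab
      · exact absurd hab (hpF' a h₁).1
      · exact absurd hab.symm (hpF' b h₂).1
      · omega
    · intro i _
      dsimp only
      split_ifs with h
      · exact (hpF' i h).2
      · exact hyF
    · intro i hi
      rcases Nat.lt_or_ge j i with h | h
      · obtain rfl : i = j + 1 := by omega
        simpa [hpj] using hs.2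
      · have h₁ : i ≤ j + 1 := by omega
        simpa [h₁, h] using hpR i h

/-- In a robust `(ν,τ)`-out- and inexpander of minimum semidegree at least `ηn`,
between any two distinct vertices `x, y` there is a path of any prescribed
orientation pattern `c` of any length `k` with `⌈2/ν⌉ ≤ k ≤ νn/4`. -/
theorem robust_diexpander_any_oriented_path :
    ∃ η₀ : ℝ, 0 < η₀ ∧ η₀ < 1 ∧ ∀ η : ℝ, 0 < η → η ≤ η₀ →
    ∃ τ₀ : ℝ, 0 < τ₀ ∧ ∀ τ : ℝ, 0 < τ → τ ≤ τ₀ → ∀ ν : ℝ, 0 < ν → ν ≤ τ →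
    ∃ n₀ : ℕ, ∀ (V : Type) [Fintype V] (G : V → V → Prop),
      (∀ v : V, ¬ G v v) →
      n₀ ≤ Fintype.card V →
      (∀ v : V, η * (Fintype.card V : ℝ) ≤ (outDeg G v : ℝ) ∧
        η * (Fintype.card V : ℝ) ≤ (inDeg G v : ℝ)) →
      RobustOutexpander G ν τ →
      RobustInexpander G ν τ →
      ∀ k : ℕ, ⌈(2 : ℝ) / ν⌉₊ ≤ k → (k : ℝ) ≤ ν * (Fintype.card V : ℝ) / 4 →
      ∀ x y : V, x ≠ y →
      ∀ c : Fin k → ℤ, (∀ i, c i = 1 ∨ c i = -1) →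
      ∃ v : Fin (k + 1) → V, Function.Injective v ∧ v 0 = x ∧ v (Fin.last k) = y ∧
        ∀ i : Fin k,
          (c i = 1 → G (v i.castSucc) (v i.succ)) ∧
          (c i = -1 → G (v i.succ) (v i.castSucc)) := by
  refine ⟨1 / 2, by norm_num, by norm_num, fun η hη _ => ⟨η / 2, by linarith, ?_⟩⟩
  intro τ hτ hτη ν hν hντ
  refine ⟨1, ?_⟩
  intro V _ G _ hV hdeg hGout hGin k hk hkn x y hxy c hc
  have hn : (0 : ℝ) < (Fintype.card V : ℝ) := by exact_mod_cast hV
  have hk2 : 2 ≤ k * ν := (div_le_iff₀ hν).mp (Nat.ceil_le.mp hk)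
  obtain ⟨m, rfl⟩ : ∃ m, k = m + 1 := Nat.exists_eq_succ_of_ne_zero (by
    rintro rfl
    norm_num at hk2)
  let R : ℕ → V → V → Prop := fun i =>
    if h : i < m + 1 then (if c ⟨i, h⟩ = 1 then G else flip G) else G
  have hR : ∀ i, R i = G ∨ R i = flip G := by
    intro i
    dsimp only [R]
    split_ifs <;> simp
  have hout : ∀ i v, η * (Fintype.card V : ℝ) ≤ (outDeg (R i) v : ℝ) := by
    intro i v
    rcases hR i with h | h <;> rw [h]
    · exact (hdeg v).1
    · exact (hdeg v).2
  have hin : ∀ i v, η * (Fintype.card V : ℝ) ≤ (inDeg (R i) v : ℝ) := by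
    intro i v
    rcases hR i with h | h <;> rw [h]
    · exact (hdeg v).2
    · exact (hdeg v).1
  have hexp : ∀ i, RobustOutexpander (R i) ν τ := by
    intro i
    rcases hR i with h | h <;> rw [h]
    · exact hGout
    · exact hGin
  have huniv : robustReach R ν x m = Finset.univ := by
    refine (robustReach_eq_univ_or_le_card hτ hν hντ (by linarith) hV hout hin hexp x m).resolve_right
      fun h => ?_
    have hle : ((robustReach R ν x m).card : ℝ) ≤ (Fintype.card V : ℝ) := by
      exact_mod_cast Finset.card_le_univ _
    push_cast at hk2
    nlinarith
  have hm : (0 : ℝ) ≤ m := Nat.cast_nonneg m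
  obtain ⟨p, hp0, hpk, hinj, -, hpR⟩ := exists_path_of_mem_robustReach (R := R) (ν := ν) (x := x) m y
    ∅ (by simp [huniv]) hxy.symm (by simp) (by simp) (by
      push_cast at hkn
      simp only [Finset.card_empty, Nat.cast_zero]
      linarith)
  refine ⟨fun i => p i, ?_, by simpa using hp0, by simpa using hpk, ?_⟩
  · intro a b hab
    exact Fin.ext (hinj (Set.mem_Iic.mpr (by omega)) (Set.mem_Iic.mpr (by omega)) hab)
  · intro i
    have h := hpR i (by omega)
    constructor <;> intro hi
    · simpa [R, hi] using h
    · simpa [R, hi, flip, Nat.le_of_lt_succ i.isLt] using h
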